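/- Consider Algorithm 1 run on an n-vertex graph G with maximum degree Δ. For any vertex v, and for any fixed choice of the permutation π and of the vertex partition χ, the probability over the edge-sampling that Z'_v > Δ^{0.86} is at most e^{−Δ^{0.01}}, where Z'_v equals Z_{v,χ(v)} if v is unmatched in M and 0 if v is matched in M. -/

import Mathlib

open Finset
open scoped Classical

section Defs

private lemma sym2_exists_mem {V : Type*} (e : Sym2 V) : ∃ a, a ∈ e :=
  ⟨(Quot.out e).1, Sym2.out_fst_mem e⟩

variable {V : Type*} [Fintype V] [DecidableEq V]

/-- The greedy maximal matching of the graph with edge set `E`, processing edges in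
increasing order of the priority function `ρ`: repeatedly pick the minimum-priority
remaining edge, add it to the matching, and discard all edges meeting it. -/
noncomputable def greedyMM {β : Type*} [LinearOrder β] (ρ : Sym2 V → β) (E : Finset (Sym2 V)) :
    Finset (Sym2 V) :=
  if h : E.Nonempty then
    insert (Classical.choose (E.exists_min_image ρ h))
      (greedyMM ρ (E.filter fun f =>
        ¬ ∃ v, v ∈ Classical.choose (E.exists_min_image ρ h) ∧ v ∈ f))
  else ∅
termination_by E.card
decreasing_by
  have he : Classical.choose (E.exists_min_image ρ h) ∈ E :=
    (Classical.choose_spec (E.exists_min_image ρ h)).1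
  apply Finset.card_lt_card
  refine (Finset.ssubset_iff_of_subset (Finset.filter_subset _ _)).2 ⟨_, he, ?_⟩
  intro hmem
  obtain ⟨a, ha⟩ := sym2_exists_mem (Classical.choose (E.exists_min_image ρ h))
  exact (Finset.mem_filter.1 hmem).2 ⟨a, ha, ha⟩

/-- The set of vertices matched by a set `M` of edges. -/
noncomputable def matchedV (M : Finset (Sym2 V)) : Finset V :=
  Finset.univ.filter fun v => ∃ e ∈ M, v ∈ e

/-- Residual degree of `v` with respect to the matching `M` in the graph with edge set `E`:
`0` if `v` is matched, and otherwise the degree of `v` in the induced subgraph on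
unmatched vertices. -/
noncomputable def resDeg (E M : Finset (Sym2 V)) (v : V) : ℕ :=
  if v ∈ matchedV M then 0
  else (E.filter fun e => v ∈ e ∧ ∀ w ∈ e, w ∉ matchedV M).card

/-- The number of vertices whose match-status differs between `M` and `M'`. -/
noncomputable def statusDiff (M M' : Finset (Sym2 V)) : ℕ :=
  (Finset.univ.filter fun v => ¬ (v ∈ matchedV M ↔ v ∈ matchedV M')).card


/-- The endpoints of an edge, as a finset. -/
noncomputable def ends (e : Sym2 V) : Finset V := Finset.univ.filter (· ∈ e)

/-- The recursive edge oracle (with bookkeeping), for the graph with (sampled) edge set `L`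
and priorities `π`, run with the partition-indicator vector `x`.
`eoQ π L x fuel e` returns a triple `(ans, qs, cnt)` where `ans` tells whether `e` joins the
greedy matching of the induced subgraph of `L` on `{v | x v}`, `qs` is the set of entries of
`x` queried, and `cnt` is the number of (recursive) oracle calls made on edges of `L` having
both endpoints in `{v | x v}` (including the call on `e` itself, when applicable).
The oracle first queries the two endpoints of `e` and answers NO if one of them is outside
the part; otherwise it recursively evaluates the incident edges of `L` of smaller priority,
in increasing order of priority, stopping as soon as one of them answers YES.
It is always invoked with `fuel = π e + 1`, which guarantees the fuel never runs out. -/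
noncomputable def eoQ (π : Sym2 V → ℕ) (L : Finset (Sym2 V)) (x : V → Bool) :
    ℕ → Sym2 V → Bool × Finset V × ℕ
  | 0, e => (false, ends e, 0)
  | fuel + 1, e =>
    if ∀ v ∈ e, x v then
      let nbrs := ((L.filter fun f => f ≠ e ∧ (∃ v, v ∈ e ∧ v ∈ f) ∧ π f < π e).toList.mergeSort
          (fun a b => decide (π a ≤ π b)))
      let r := nbrs.foldl (fun (s : Bool × Finset V × ℕ) f =>
          if s.1 then s
          else
            let t := eoQ π L x fuel f
            (t.1, s.2.1 ∪ t.2.1, s.2.2 + t.2.2)) (false, ∅, 0)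
      (!r.1, ends e ∪ r.2.1, (if e ∈ L then 1 else 0) + r.2.2)
    else (false, ends e, 0)

/-- Whether `e` belongs to the greedy matching, as decided by the edge oracle. -/
noncomputable def edgeOracle (π : Sym2 V → ℕ) (L : Finset (Sym2 V)) (x : V → Bool)
    (e : Sym2 V) : Bool × Finset V × ℕ :=
  eoQ π L x (π e + 1) e

/-- The degree oracle for vertex `v`: determines `Z_{v,1}`, the number of neighbors of `v`
(in the graph with edge set `Ed`) lying in the part `{u | x u}` that are unmatched in the
greedy matching of the induced subgraph of `L`.  For each neighbor `u` of `v` it queries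
`x u`, and if `x u = 1`, it runs the edge oracle on every edge of `L` incident to `u`.
Returns `(Z value, set of entries of x queried, number of oracle calls on edges inside the part)`. -/
noncomputable def degOr (Ed : Finset (Sym2 V)) (π : Sym2 V → ℕ) (L : Finset (Sym2 V))
    (x : V → Bool) (v : V) : ℕ × Finset V × ℕ :=
  let Nv := Finset.univ.filter fun u => s(u, v) ∈ Ed
  let q := Nv ∪ (Nv.filter fun u => x u).biUnion fun u =>
      (Finset.univ.filter fun w => s(u, w) ∈ L).biUnion fun w =>
        (edgeOracle π L x s(u, w)).2.1
  let c := ∑ u ∈ Nv.filter (fun u => x u), ∑ w ∈ Finset.univ.filter (fun w => s(u, w) ∈ L),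
        (edgeOracle π L x s(u, w)).2.2
  ((Nv.filter fun u => x u ∧ ∀ w ∈ Finset.univ.filter (fun w => s(u, w) ∈ L),
      (edgeOracle π L x s(u, w)).1 = false).card, q, c)

/-- `B v`: the number of entries of `x` queried during the execution of the degree oracle. -/
noncomputable def Bqueries (Ed : Finset (Sym2 V)) (π : Sym2 V → ℕ) (L : Finset (Sym2 V))
    (x : V → Bool) (v : V) : ℕ :=
  (degOr Ed π L x v).2.1.card

/-- The priority function on edges induced by a permutation `τ` of `Fin E.card`,
via the canonical enumeration of `E`; edges outside `E` get priority `0`. -/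
noncomputable def prioOf (E : Finset (Sym2 V)) (τ : Equiv.Perm (Fin E.card)) (e : Sym2 V) : ℕ :=
  if h : e ∈ E then (τ (E.equivFin ⟨e, h⟩) : ℕ) else 0

/-- `L₁`: the set of edges of `L` with both endpoints inside the part `{v | x v}`. -/
noncomputable def partEdges (L : Finset (Sym2 V)) (x : V → Bool) : Finset (Sym2 V) :=
  L.filter fun e => ∀ v ∈ e, x v

/-- `Z_{v,1}(x)`: the number of neighbors of `v` in the graph `Ed` lying in the part
`{u | x u}` that are unmatched in `M₁ = GreedyMM(L₁, π)`. -/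
noncomputable def Zv1 (Ed : Finset (Sym2 V)) (π : Sym2 V → ℕ) (L : Finset (Sym2 V))
    (x : V → Bool) (v : V) : ℕ :=
  (Finset.univ.filter fun u =>
    s(u, v) ∈ Ed ∧ x u ∧ u ∉ matchedV (greedyMM π (partEdges L x))).card


/-- The matching output by Algorithm 1: the union over all parts `i ∈ [k]` of the greedy
maximal matching (w.r.t. the priorities `π`) of the induced subgraph of the sampled edge
set `L` on the part `V_i = χ⁻¹(i)`. -/
noncomputable def algoMatching (π : Sym2 V → ℕ) (k : ℕ) (χ : V → Fin k)
    (L : Finset (Sym2 V)) : Finset (Sym2 V) :=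
  (Finset.univ : Finset (Fin k)).biUnion fun i =>
    greedyMM π (L.filter fun e => ∀ w ∈ e, χ w = i)

/-- `Z_{v,i}`: the number of neighbors of `v` in the graph `Ed` that lie in part `V_i`
and are unmatched in the matching `M` output by Algorithm 1. -/
noncomputable def Zvi (Ed : Finset (Sym2 V)) (π : Sym2 V → ℕ) (k : ℕ) (χ : V → Fin k)
    (L : Finset (Sym2 V)) (v : V) (i : Fin k) : ℕ :=
  (Finset.univ.filter fun u =>
    s(u, v) ∈ Ed ∧ χ u = i ∧ u ∉ matchedV (algoMatching π k χ L)).card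

/-- `Z'_v`: equal to `Z_{v, χ(v)}` if `v` is unmatched in the output `M` of Algorithm 1,
and `0` if `v` is matched in `M`. -/
noncomputable def Zself (Ed : Finset (Sym2 V)) (π : Sym2 V → ℕ) (k : ℕ) (χ : V → Fin k)
    (L : Finset (Sym2 V)) (v : V) : ℕ :=
  if v ∈ matchedV (algoMatching π k χ L) then 0 else Zvi Ed π k χ L v (χ v)

/-- The Bernoulli product weight of the edge sample `S ⊆ Ed`, each edge kept with
probability `p`. -/
noncomputable def bwE (p : ℝ) (Ed S : Finset (Sym2 V)) : ℝ :=
  p ^ S.card * (1 - p) ^ (Ed.card - S.card)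

/-- The Bernoulli product weight of the indicator vector `x : V → Bool`, each coordinate
equal to `true` independently with probability `q`. -/
noncomputable def bwX (q : ℝ) (x : V → Bool) : ℝ :=
  q ^ (Finset.univ.filter fun v => x v = true).card *
    (1 - q) ^ (Finset.univ.filter fun v => x v = false).card

end Defs

section Helpers

variable {V : Type*}

/-- The probability that a Bernoulli(`p`) sample of `A` satisfies `P`. -/
noncomputable def sampleProb (p : ℝ) (A : Finset (Sym2 V)) (P : Finset (Sym2 V) → Prop) : ℝ :=
  ∑ S ∈ A.powerset, if P S then bwE p A S else 0

theorem bwE_nonneg {p : ℝ} (hp₀ : 0 ≤ p) (hp₁ : p ≤ 1) (A S : Finset (Sym2 V)) :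
    0 ≤ bwE p A S :=
  mul_nonneg (pow_nonneg hp₀ _) (pow_nonneg (sub_nonneg.2 hp₁) _)

theorem sampleProb_mono {p : ℝ} (hp₀ : 0 ≤ p) (hp₁ : p ≤ 1) {A : Finset (Sym2 V)}
    {P Q : Finset (Sym2 V) → Prop} (h : ∀ S ⊆ A, P S → Q S) :
    sampleProb p A P ≤ sampleProb p A Q := by
  refine Finset.sum_le_sum fun S hS => ?_
  have hw := bwE_nonneg hp₀ hp₁ A S
  have hPQ := h S (Finset.mem_powerset.1 hS)
  split_ifs <;> first | exact le_rfl | exact hw | exact absurd (hPQ ‹_›) ‹_›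

variable [DecidableEq V]

theorem sampleProb_insert (p : ℝ) {a : Sym2 V} {A : Finset (Sym2 V)} (ha : a ∉ A)
    (P : Finset (Sym2 V) → Prop) :
    sampleProb p (insert a A) P =
      p * sampleProb p A (fun S => P (insert a S)) + (1 - p) * sampleProb p A P := by
  unfold sampleProb
  rw [Finset.sum_powerset_insert ha, add_comm, Finset.mul_sum, Finset.mul_sum]
  congr 1
  · refine Finset.sum_congr rfl fun S hS => ?_
    have haS : a ∉ S := fun h => ha (Finset.mem_powerset.1 hS h)
    rw [mul_ite, mul_zero]
    congr 1
    simp only [bwE, Finset.card_insert_of_notMem ha, Finset.card_insert_of_notMem haS,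
      Nat.add_sub_add_right]
    ring
  · refine Finset.sum_congr rfl fun S hS => ?_
    have hc := Finset.card_le_card (Finset.mem_powerset.1 hS)
    rw [mul_ite, mul_zero]
    congr 1
    simp only [bwE, Finset.card_insert_of_notMem ha, Nat.succ_sub hc, pow_succ]
    ring

theorem sampleProb_filter (p : ℝ) (q : Sym2 V → Prop) [DecidablePred q] (A : Finset (Sym2 V))
    (P : Finset (Sym2 V) → Prop) :
    sampleProb p A (fun S => P (S.filter q)) = sampleProb p (A.filter q) P := by
  induction A using Finset.induction_on generalizing P with
  | empty => simp [sampleProb]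
  | insert a A ha ih =>
    rw [sampleProb_insert p ha]
    by_cases hq : q a
    · rw [Finset.filter_insert, if_pos hq,
        sampleProb_insert p (fun h => ha (Finset.mem_filter.1 h).1)]
      simp only [Finset.filter_insert, if_pos hq]
      rw [ih P, ih fun S => P (insert a S)]
    · simp only [Finset.filter_insert, if_neg hq]
      rw [ih P]
      ring

variable [Fintype V]

theorem greedyMM_subset {β : Type*} [LinearOrder β] (ρ : Sym2 V → β) (A : Finset (Sym2 V)) :
    greedyMM ρ A ⊆ A := by
  induction A using Finset.strongInduction with
  | H A ih =>
    rw [greedyMM]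
    split_ifs with h
    · have he := (Classical.choose_spec (A.exists_min_image ρ h)).1
      refine Finset.insert_subset he ((ih _ ?_).trans (Finset.filter_subset _ _))
      refine (Finset.ssubset_iff_of_subset (Finset.filter_subset _ _)).2 ⟨_, he, fun hmem => ?_⟩
      exact (Finset.mem_filter.1 hmem).2 ⟨_, Sym2.out_fst_mem _, Sym2.out_fst_mem _⟩
    · exact Finset.empty_subset _

theorem greedyMM_eq_insert_of_min {β : Type*} [LinearOrder β] (ρ : Sym2 V → β)
    {A : Finset (Sym2 V)} {e : Sym2 V} (he : e ∈ A) (hmin : ∀ f ∈ A, ρ f ≤ ρ e → f = e) :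
    greedyMM ρ A =
      insert e (greedyMM ρ (A.filter fun f => ¬ ∃ v, v ∈ e ∧ v ∈ f)) := by
  have h : A.Nonempty := ⟨e, he⟩
  have hspec := Classical.choose_spec (A.exists_min_image ρ h)
  have hc : Classical.choose (A.exists_min_image ρ h) = e :=
    hmin _ hspec.1 (hspec.2 e he)
  rw [greedyMM, dif_pos h, hc]

theorem mem_matchedV {M : Finset (Sym2 V)} {v : V} : v ∈ matchedV M ↔ ∃ e ∈ M, v ∈ e := by
  simp [matchedV]

theorem mem_matchedV_insert {M : Finset (Sym2 V)} {e : Sym2 V} {v : V} :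
    v ∈ matchedV (insert e M) ↔ v ∈ e ∨ v ∈ matchedV M := by
  simp [mem_matchedV]

theorem mem_matchedV_algoMatching (π : Sym2 V → ℕ) (k : ℕ) (χ : V → Fin k)
    (S : Finset (Sym2 V)) (u : V) :
    u ∈ matchedV (algoMatching π k χ S) ↔
      u ∈ matchedV (greedyMM π (S.filter fun e => ∀ w ∈ e, χ w = χ u)) := by
  simp only [mem_matchedV, algoMatching, Finset.mem_biUnion, Finset.mem_univ, true_and]
  constructor
  · rintro ⟨e, ⟨i, he⟩, hu⟩
    obtain rfl := (Finset.mem_filter.1 (greedyMM_subset π _ he)).2 u hu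
    exact ⟨e, he, hu⟩
  · rintro ⟨e, he, hu⟩
    exact ⟨e, ⟨_, he⟩, hu⟩

/-- The neighbors of `v` in the graph `A` left unmatched by the greedy matching of `S`. -/
noncomputable def unmatchedNbrs (π : Sym2 V → ℕ) (v : V) (A S : Finset (Sym2 V)) : Finset V :=
  Finset.univ.filter fun u => s(u, v) ∈ A ∧ u ∉ matchedV (greedyMM π S)

/-- If each edge of `A` is sampled with probability `p`, it is exponentially unlikely that the
greedy matching of the sample leaves unmatched both `v` and at least `t` of its neighbors. -/
theorem sampleProb_unmatched_le {p : ℝ} (hp₀ : 0 ≤ p) (hp₁ : p ≤ 1) (π : Sym2 V → ℕ) (v : V)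
    (A : Finset (Sym2 V)) (hπ : Set.InjOn π ↑A) (t : ℕ) :
    sampleProb p A (fun S => v ∉ matchedV (greedyMM π S) ∧ t ≤ (unmatchedNbrs π v A S).card) ≤
      (1 - p) ^ t := by
  have hq₀ : 0 ≤ 1 - p := sub_nonneg.2 hp₁
  induction A using Finset.strongInduction generalizing t with
  | H A ih =>
    rcases A.eq_empty_or_nonempty with rfl | hne
    · rcases Nat.eq_zero_or_pos t with rfl | ht
      · simp only [sampleProb, Finset.powerset_empty, Finset.sum_singleton]
        split_ifs <;> simp [bwE]
      · have : ¬ t ≤ 0 := by omega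
        simp [sampleProb, unmatchedNbrs, this, pow_nonneg hq₀]
    · obtain ⟨e, he, hle⟩ := A.exists_min_image π hne
      have hmin : ∀ f ∈ A, π f ≤ π e → f = e := fun f hf hfe =>
        hπ hf he (le_antisymm hfe (hle f hf))
      have heB : e ∉ A.erase e := Finset.notMem_erase e A
      have hBA : A.erase e ⊂ A := Finset.erase_ssubset he
      have hgreedy : ∀ S ⊆ A.erase e, greedyMM π (insert e S) =
          insert e (greedyMM π (S.filter fun f => ¬ ∃ v, v ∈ e ∧ v ∈ f)) := by
        intro S hS
        rw [greedyMM_eq_insert_of_min π (Finset.mem_insert_self e S) fun f hf => hmin f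
          (Finset.insert_subset he (hS.trans (Finset.erase_subset e A)) hf)]
        rw [Finset.filter_insert, if_neg]
        exact not_not.2 ⟨_, Sym2.out_fst_mem e, Sym2.out_fst_mem e⟩
      have hsplit := sampleProb_insert p heB
        (fun S => v ∉ matchedV (greedyMM π S) ∧ t ≤ (unmatchedNbrs π v A S).card)
      rw [Finset.insert_erase he] at hsplit
      rw [hsplit]
      by_cases hv : v ∈ e
      · have hzero : sampleProb p (A.erase e) (fun S => v ∉ matchedV (greedyMM π (insert e S)) ∧
            t ≤ (unmatchedNbrs π v A (insert e S)).card) = 0 := by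
          refine Finset.sum_eq_zero fun S hS => if_neg fun h => h.1 ?_
          rw [hgreedy S (Finset.mem_powerset.1 hS)]
          exact mem_matchedV_insert.2 (Or.inl hv)
        have hstep : sampleProb p (A.erase e) (fun S => v ∉ matchedV (greedyMM π S) ∧
            t ≤ (unmatchedNbrs π v A S).card) ≤ (1 - p) ^ (t - 1) := by
          refine (sampleProb_mono hp₀ hp₁ fun S _ h => ⟨h.1, ?_⟩).trans
            (ih _ hBA (hπ.mono (Finset.coe_subset.2 hBA.subset)) (t - 1))
          obtain ⟨w, rfl⟩ := Sym2.mem_iff_exists.1 hv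
          have hsub : unmatchedNbrs π v A S ⊆
              insert w (unmatchedNbrs π v (A.erase s(v, w)) S) := by
            intro u hu
            simp only [unmatchedNbrs, Finset.mem_insert, Finset.mem_filter, Finset.mem_univ,
              true_and, Finset.mem_erase] at hu ⊢
            by_cases huw : u = w
            · exact Or.inl huw
            · refine Or.inr ⟨⟨fun h => huw ?_, hu.1⟩, hu.2⟩
              rw [Sym2.eq_swap] at h
              exact Sym2.congr_right.1 h
          have := (Finset.card_le_card hsub).trans (Finset.card_insert_le _ _)
          have := h.2
          omega
        rw [hzero, mul_zero, zero_add]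
        refine (mul_le_mul_of_nonneg_left hstep hq₀).trans ?_
        rcases t with _ | t
        · simpa using hp₀
        · simp [pow_succ, mul_comm]
      · have hmiss : sampleProb p (A.erase e) (fun S => v ∉ matchedV (greedyMM π S) ∧
            t ≤ (unmatchedNbrs π v A S).card) ≤ (1 - p) ^ t := by
          refine (sampleProb_mono hp₀ hp₁ fun S _ h => ⟨h.1, h.2.trans ?_⟩).trans
            (ih _ hBA (hπ.mono (Finset.coe_subset.2 hBA.subset)) t)
          refine Finset.card_le_card fun u hu => ?_
          simp only [unmatchedNbrs, Finset.mem_filter, Finset.mem_univ, true_and,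
            Finset.mem_erase] at hu ⊢
          exact ⟨⟨fun h => hv (h ▸ Sym2.mem_mk_right u v), hu.1⟩, hu.2⟩
        have hhit : sampleProb p (A.erase e) (fun S => v ∉ matchedV (greedyMM π (insert e S)) ∧
            t ≤ (unmatchedNbrs π v A (insert e S)).card) ≤ (1 - p) ^ t := by
          have hsub : (A.erase e).filter (fun f => ¬ ∃ v, v ∈ e ∧ v ∈ f) ⊆ A.erase e :=
            Finset.filter_subset _ _
          refine le_trans ?_ (ih _ (Finset.ssubset_of_subset_of_ssubset hsub hBA)
            (hπ.mono (Finset.coe_subset.2 (hsub.trans hBA.subset))) t)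
          rw [← sampleProb_filter p (fun f => ¬ ∃ v, v ∈ e ∧ v ∈ f) _ (fun S => _ ∧ _)]
          refine sampleProb_mono hp₀ hp₁ fun S hS h => ?_
          rw [unmatchedNbrs, hgreedy S hS] at h
          refine ⟨fun h' => h.1 (mem_matchedV_insert.2 (Or.inr h')), h.2.trans ?_⟩
          refine Finset.card_le_card fun u hu => ?_
          simp only [unmatchedNbrs, Finset.mem_filter, Finset.mem_univ, true_and,
            Finset.mem_erase, mem_matchedV_insert, not_or] at hu ⊢
          refine ⟨⟨⟨fun h => hv (h ▸ Sym2.mem_mk_right u v), hu.1⟩, ?_⟩, hu.2.2⟩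
          rintro ⟨w, hwe, hw⟩
          rcases Sym2.mem_iff.1 hw with rfl | rfl
          · exact hu.2.1 hwe
          · exact hv hwe
        calc _ ≤ p * (1 - p) ^ t + (1 - p) * (1 - p) ^ t :=
              add_le_add (mul_le_mul_of_nonneg_left hhit hp₀)
                (mul_le_mul_of_nonneg_left hmiss hq₀)
          _ = (1 - p) ^ t := by ring

theorem Zself_pos_imp_unmatched (E : Finset (Sym2 V)) (π : Sym2 V → ℕ) (k : ℕ) (χ : V → Fin k)
    (S : Finset (Sym2 V)) (v : V) (hZ : 0 < Zself E π k χ S v) :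
    v ∉ matchedV (greedyMM π (S.filter fun e => ∀ w ∈ e, χ w = χ v)) ∧
      Zself E π k χ S v ≤ (unmatchedNbrs π v (E.filter fun e => ∀ w ∈ e, χ w = χ v)
        (S.filter fun e => ∀ w ∈ e, χ w = χ v)).card := by
  unfold Zself at hZ ⊢
  split_ifs at hZ ⊢ with hv
  · exact absurd hZ (lt_irrefl 0)
  · rw [mem_matchedV_algoMatching] at hv
    refine ⟨hv, Finset.card_le_card fun u hu => ?_⟩
    simp only [unmatchedNbrs, Finset.mem_filter, Finset.mem_univ, true_and,
      mem_matchedV_algoMatching] at hu ⊢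
    obtain ⟨huE, hχ, hu⟩ := hu
    rw [hχ] at hu
    refine ⟨⟨huE, fun w hw => ?_⟩, hu⟩
    rcases Sym2.mem_iff.1 hw with rfl | rfl
    · exact hχ
    · rfl

end Helpers

/-- **Intra-partition residual degrees are small** (Claim 4.2).
Run Algorithm 1 on an `n`-vertex graph `G = (V, E)` with maximum degree `Δ`
(edge-sampling probability `p = Δ^{-0.85}`, `k = Δ^{0.1}` parts).  For any vertex `v` and
any fixed choice of the permutation `π` (an injective priority assignment on `E`) and of
the vertex partition `χ`, the probability over the edge-sampling (modeled by summing the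
Bernoulli product weights of the samples `S ⊆ E`) that `Z'_v > Δ^{0.86}` is at most
`e^{-Δ^{0.01}}`. -/
theorem intra_partition_degree_bound
    {V : Type*} [Fintype V] [DecidableEq V]
    (E : Finset (Sym2 V)) (hE : ∀ e ∈ E, ¬ e.IsDiag)
    (Δ : ℕ) (hdeg : ∀ v : V, (E.filter fun e => v ∈ e).card ≤ Δ) (hΔ : 1 ≤ Δ)
    (p : ℝ) (hp : p = (Δ : ℝ) ^ (-(0.85 : ℝ)))
    (k : ℕ) (hk : (k : ℝ) = (Δ : ℝ) ^ ((0.1 : ℝ)))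
    (π : Sym2 V → ℕ) (hπ : Set.InjOn π ↑E)
    (χ : V → Fin k) (v : V) :
    ∑ S ∈ E.powerset,
        (if (Δ : ℝ) ^ ((0.86 : ℝ)) < (Zself E π k χ S v : ℝ) then bwE p E S else 0) ≤
      Real.exp (-(Δ : ℝ) ^ ((0.01 : ℝ))) := by
  have hΔ' : (1 : ℝ) ≤ Δ := by exact_mod_cast hΔ
  have hΔ₀ : (0 : ℝ) < Δ := by linarith
  have hp₀ : 0 ≤ p := hp ▸ Real.rpow_nonneg hΔ₀.le _
  have hp₁ : p ≤ 1 := hp ▸ Real.rpow_le_one_of_one_le_of_nonpos hΔ' (by norm_num)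
  set T : ℝ := (Δ : ℝ) ^ (0.86 : ℝ) with hT
  have hT₀ : 0 ≤ T := Real.rpow_nonneg hΔ₀.le _
  have hpT : p * T = (Δ : ℝ) ^ (0.01 : ℝ) := by
    rw [hp, hT, ← Real.rpow_add hΔ₀]
    norm_num
  calc
    _ = sampleProb p E (fun S => T < (Zself E π k χ S v : ℝ)) := by
      simp only [sampleProb]
    _ ≤ sampleProb p E (fun S =>
          v ∉ matchedV (greedyMM π (S.filter fun e => ∀ w ∈ e, χ w = χ v)) ∧
          ⌈T⌉₊ ≤ (unmatchedNbrs π v (E.filter fun e => ∀ w ∈ e, χ w = χ v)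
            (S.filter fun e => ∀ w ∈ e, χ w = χ v)).card) := by
      refine sampleProb_mono hp₀ hp₁ fun S _ h => ?_
      have hZ := Zself_pos_imp_unmatched E π k χ S v (by exact_mod_cast hT₀.trans_lt h)
      exact ⟨hZ.1, (Nat.ceil_le.2 h.le).trans hZ.2⟩
    _ = sampleProb p (E.filter fun e => ∀ w ∈ e, χ w = χ v) (fun S =>
          v ∉ matchedV (greedyMM π S) ∧
          ⌈T⌉₊ ≤ (unmatchedNbrs π v (E.filter fun e => ∀ w ∈ e, χ w = χ v) S).card) :=
      sampleProb_filter p (fun e => ∀ w ∈ e, χ w = χ v) E (fun S =>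
          v ∉ matchedV (greedyMM π S) ∧
          ⌈T⌉₊ ≤ (unmatchedNbrs π v (E.filter fun e => ∀ w ∈ e, χ w = χ v) S).card)
    _ ≤ (1 - p) ^ ⌈T⌉₊ :=
      sampleProb_unmatched_le hp₀ hp₁ π v _
        (hπ.mono (Finset.coe_subset.2 (Finset.filter_subset _ _))) _
    _ ≤ Real.exp (-p) ^ ⌈T⌉₊ :=
      pow_le_pow_left₀ (sub_nonneg.2 hp₁) (Real.one_sub_le_exp_neg p) _
    _ ≤ Real.exp (-(Δ : ℝ) ^ (0.01 : ℝ)) := by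
      rw [← Real.exp_nat_mul, ← hpT]
      refine Real.exp_le_exp.2 ?_
      have := mul_le_mul_of_nonneg_left (Nat.le_ceil T) hp₀
      linarith
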